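/- (Binary Darboux transformation for the Hirota–Miwa equation.) Let a_1, a_2, a_3 be nonzero complex numbers and let τ : ℤ³ × ℝ → ℂ be nowhere vanishing, smooth in x, and satisfy the semi-discrete KP equation. Let θ and φ be smooth solutions of the forward linear system with potential τ, and let ρ and ψ be smooth solutions of the backward linear system with potential τ. Suppose ω_{θρ}, ω_{φρ}, ω_{θψ} : ℤ³ × ℝ → ℂ are smooth functions satisfying, for every i = 1,2,3, a_i((ω_{θρ})_i − ω_{θρ}) = θ ρ_i, a_i((ω_{φρ})_i − ω_{φρ}) = φ ρ_i, a_i((ω_{θψ})_i − ω_{θψ}) = θ ψ_i, and (ω_{θρ})_x = θρ, (ω_{φρ})_x = φρ, (ω_{θψ})_x = θψ, and suppose ω_{θρ} is nowhere zero. Then φ̂ := φ − θ·ω_{θρ}^{−1}·ω_{φρ} satisfies the forward linear system with potential τ̂ := ω_{θρ}·τ, and ψ̂ := ψ − ρ·ω_{θρ}^{−1}·ω_{θψ} satisfies the backward linear system with potential τ̂. -/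

import Mathlib

noncomputable section

/-- Forward shift in the `i`-th discrete direction of `ℤ³`. -/
def fwd (i : Fin 3) (n : Fin 3 → ℤ) : Fin 3 → ℤ := Function.update n i (n i + 1)

/-- Backward shift in the `i`-th discrete direction of `ℤ³`. -/
def bwd (i : Fin 3) (n : Fin 3 → ℤ) : Fin 3 → ℤ := Function.update n i (n i - 1)

/-- The semi-discrete KP equation:
`(a_i − a_j)(τ_{ij}τ − τ_i τ_j) + τ_{i,x} τ_j − τ_i τ_{j,x} = 0` for all `1 ≤ i < j ≤ 3`. -/
def SemiKP (a : Fin 3 → ℂ) (τ : (Fin 3 → ℤ) → ℝ → ℂ) : Prop :=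
  ∀ i j : Fin 3, i < j → ∀ n x,
    (a i - a j) * (τ (fwd i (fwd j n)) x * τ n x - τ (fwd i n) x * τ (fwd j n) x)
      + deriv (τ (fwd i n)) x * τ (fwd j n) x - τ (fwd i n) x * deriv (τ (fwd j n)) x = 0

/-- The forward linear system for `φ` with potential `τ`:
`a_i φ_i − a_j φ_j = (a_i − a_j)(τ_{ij}τ/(τ_i τ_j))φ` for `1 ≤ i < j ≤ 3`, together with
`φ_x = a_i φ_i + ((τ_x/τ)_i − τ_x/τ − a_i)φ` for `i = 1,2,3`. -/
def FwdLin (a : Fin 3 → ℂ) (τ φ : (Fin 3 → ℤ) → ℝ → ℂ) : Prop :=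
  (∀ i j : Fin 3, i < j → ∀ n x,
    a i * φ (fwd i n) x - a j * φ (fwd j n) x
      = (a i - a j) * (τ (fwd i (fwd j n)) x * τ n x / (τ (fwd i n) x * τ (fwd j n) x))
          * φ n x)
  ∧ ∀ i : Fin 3, ∀ n x,
      deriv (φ n) x = a i * φ (fwd i n) x
        + (deriv (τ (fwd i n)) x / τ (fwd i n) x - deriv (τ n) x / τ n x - a i) * φ n x

/-- The backward linear system for `ψ` with potential `τ`:
`a_i ψ_ī − a_j ψ_j̄ = (a_i − a_j)(τ_{īj̄}τ/(τ_ī τ_j̄))ψ` for `1 ≤ i < j ≤ 3`, together with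
`ψ_x = −a_i ψ_ī + ((τ_x/τ)_ī − τ_x/τ + a_i)ψ` for `i = 1,2,3`. -/
def BwdLin (a : Fin 3 → ℂ) (τ ψ : (Fin 3 → ℤ) → ℝ → ℂ) : Prop :=
  (∀ i j : Fin 3, i < j → ∀ n x,
    a i * ψ (bwd i n) x - a j * ψ (bwd j n) x
      = (a i - a j) * (τ (bwd i (bwd j n)) x * τ n x / (τ (bwd i n) x * τ (bwd j n) x))
          * ψ n x)
  ∧ ∀ i : Fin 3, ∀ n x,
      deriv (ψ n) x = -(a i) * ψ (bwd i n) x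
        + (deriv (τ (bwd i n)) x / τ (bwd i n) x - deriv (τ n) x / τ n x + a i) * ψ n x

lemma bwd_fwd (i : Fin 3) (n : Fin 3 → ℤ) : bwd i (fwd i n) = n := by
  simp [fwd, bwd]

lemma fwd_comm (i j : Fin 3) (n : Fin 3 → ℤ) : fwd i (fwd j n) = fwd j (fwd i n) := by
  rcases eq_or_ne i j with rfl | h
  · rfl
  · simp [fwd, h, h.symm, Function.update_comm h]

lemma fwd_bwd (i : Fin 3) (n : Fin 3 → ℤ) : fwd i (bwd i n) = n := by
  simp [fwd, bwd]

lemma bwd_comm (i j : Fin 3) (n : Fin 3 → ℤ) : bwd i (bwd j n) = bwd j (bwd i n) := by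
  rcases eq_or_ne i j with rfl | h
  · rfl
  · simp [bwd, h, h.symm, Function.update_comm h]

/-- Pointwise algebra behind the discrete part of the binary Darboux transformation; the
backward system is covered by negating `a`, `b` and `k`. -/
lemma darboux_discrete {K : Type*} [Field K]
    {a b k θ θi θj φ φi φj ρi ρj ρij ω ωi ωj ωij Ω Ωi Ωj : K} (ha : a ≠ 0) (hb : b ≠ 0)
    (hω : ω ≠ 0) (hωi0 : ωi ≠ 0) (hωj0 : ωj ≠ 0)
    (hθ : a * θi - b * θj = k * θ) (hφ : a * φi - b * φj = k * φ)
    (hρ : a * ρj - b * ρi = k * ρij)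
    (hωi : a * (ωi - ω) = θ * ρi) (hωj : b * (ωj - ω) = θ * ρj)
    (hωij : a * (ωij - ωj) = θj * ρij)
    (hΩi : a * (Ωi - Ω) = φ * ρi) (hΩj : b * (Ωj - Ω) = φ * ρj) :
    a * (φi - θi * ωi⁻¹ * Ωi) - b * (φj - θj * ωj⁻¹ * Ωj)
      = k * (ωij * ω / (ωi * ωj)) * (φ - θ * ω⁻¹ * Ω) := by
  have key : k * φ * ωi * ωj - (b * θj + k * θ) * Ωi * ωj + b * θj * Ωj * ωi
      = (k * ωij) * (φ * ω - θ * Ω) := by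
    have hk : k * ωij = k * ωj + θj * (a * ρj - b * ρi) / a := by
      field_simp
      linear_combination k * hωij - θj * hρ
    have e1 : ωi = ω + θ * ρi / a := by field_simp; linear_combination hωi
    have e2 : ωj = ω + θ * ρj / b := by field_simp; linear_combination hωj
    have e3 : Ωi = Ω + φ * ρi / a := by field_simp; linear_combination hΩi
    have e4 : Ωj = Ω + φ * ρj / b := by field_simp; linear_combination hΩj
    rw [hk, e1, e2, e3, e4]
    field_simp
    ring
  field_simp
  linear_combination key + ωi * ωj * hφ - Ωi * ωj * hθ

/-- Pointwise algebra behind the continuous part of the binary Darboux transformation, where `u`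
and `v` are the logarithmic derivatives of the shifted and unshifted potential; the backward
system is covered by negating `a`. -/
lemma darboux_continuous {K : Type*} [Field K]
    {a u v θ θi θx φ φi φx ρ ρi ω ωi Ω Ωi : K}
    (hω : ω ≠ 0) (hωi0 : ωi ≠ 0)
    (hθ : θx = a * θi + (u - v - a) * θ) (hφ : φx = a * φi + (u - v - a) * φ)
    (hωi : a * (ωi - ω) = θ * ρi) (hΩi : a * (Ωi - Ω) = φ * ρi) :
    φx - ((θx * ω⁻¹ + θ * (-(θ * ρ) / ω ^ 2)) * Ω + θ * ω⁻¹ * (φ * ρ))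
      = a * (φi - θi * ωi⁻¹ * Ωi)
        + ((θi * ρi / ωi + u) - (θ * ρ / ω + v) - a) * (φ - θ * ω⁻¹ * Ω) := by
  subst hθ hφ
  field_simp
  linear_combination θi * ω * ω * hΩi - θi * ω * Ω * hωi

lemma deriv_darboux {φ θ ω Ω : ℝ → ℂ} {x : ℝ} (hφ : DifferentiableAt ℝ φ x)
    (hθ : DifferentiableAt ℝ θ x) (hω : DifferentiableAt ℝ ω x) (hΩ : DifferentiableAt ℝ Ω x)
    (h0 : ω x ≠ 0) :
    deriv (fun x => φ x - θ x * (ω x)⁻¹ * Ω x) x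
      = deriv φ x - ((deriv θ x * (ω x)⁻¹ + θ x * (-deriv ω x / ω x ^ 2)) * Ω x
          + θ x * (ω x)⁻¹ * deriv Ω x) :=
  (hφ.hasDerivAt.sub ((hθ.hasDerivAt.mul (hω.hasDerivAt.inv h0)).mul hΩ.hasDerivAt)).deriv

lemma deriv_mul_div_self {ω τ : ℝ → ℂ} {x : ℝ} (hω : DifferentiableAt ℝ ω x)
    (hτ : DifferentiableAt ℝ τ x) (hω0 : ω x ≠ 0) (hτ0 : τ x ≠ 0) :
    deriv (fun x => ω x * τ x) x / (ω x * τ x) = deriv ω x / ω x + deriv τ x / τ x := by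
  rw [show deriv (fun x => ω x * τ x) x = deriv ω x * τ x + ω x * deriv τ x from
    (hω.hasDerivAt.mul hτ.hasDerivAt).deriv]
  field_simp

/-- Binary Darboux transformation for the Hirota–Miwa equation: with `θ, φ` solutions of
the forward linear system and `ρ, ψ` solutions of the backward linear system with potential
`τ`, and with potentials `ω(θ,ρ), ω(φ,ρ), ω(θ,ψ)` satisfying `Δ_i ω = (first)·(second)_i`
and `ω_x = (first)·(second)`, where `Δ_i = a_i(T_i − 1)`, and `ω(θ,ρ)` nowhere zero, the
functions `φ̂ = φ − θ·ω(θ,ρ)⁻¹·ω(φ,ρ)` and `ψ̂ = ψ − ρ·ω(θ,ρ)⁻¹·ω(θ,ψ)` satisfy the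
forward, resp. backward, linear system with potential `τ̂ = ω(θ,ρ)·τ`. -/
theorem binary_darboux_hirota_miwa
    (a : Fin 3 → ℂ) (ha : ∀ i, a i ≠ 0)
    (τ θ φ ρ ψ ωθρ ωφρ ωθψ : (Fin 3 → ℤ) → ℝ → ℂ)
    (hτ0 : ∀ n x, τ n x ≠ 0)
    (hτsmooth : ∀ n, ContDiff ℝ (⊤ : ℕ∞) (τ n))
    (hKP : SemiKP a τ)
    (hθsmooth : ∀ n, ContDiff ℝ (⊤ : ℕ∞) (θ n))
    (hφsmooth : ∀ n, ContDiff ℝ (⊤ : ℕ∞) (φ n))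
    (hρsmooth : ∀ n, ContDiff ℝ (⊤ : ℕ∞) (ρ n))
    (hψsmooth : ∀ n, ContDiff ℝ (⊤ : ℕ∞) (ψ n))
    (hθ : FwdLin a τ θ) (hφ : FwdLin a τ φ)
    (hρ : BwdLin a τ ρ) (hψ : BwdLin a τ ψ)
    (hωθρsmooth : ∀ n, ContDiff ℝ (⊤ : ℕ∞) (ωθρ n))
    (hωφρsmooth : ∀ n, ContDiff ℝ (⊤ : ℕ∞) (ωφρ n))
    (hωθψsmooth : ∀ n, ContDiff ℝ (⊤ : ℕ∞) (ωθψ n))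
    (hωθρd : ∀ i : Fin 3, ∀ n x, a i * (ωθρ (fwd i n) x - ωθρ n x) = θ n x * ρ (fwd i n) x)
    (hωφρd : ∀ i : Fin 3, ∀ n x, a i * (ωφρ (fwd i n) x - ωφρ n x) = φ n x * ρ (fwd i n) x)
    (hωθψd : ∀ i : Fin 3, ∀ n x, a i * (ωθψ (fwd i n) x - ωθψ n x) = θ n x * ψ (fwd i n) x)
    (hωθρx : ∀ n x, deriv (ωθρ n) x = θ n x * ρ n x)
    (hωφρx : ∀ n x, deriv (ωφρ n) x = φ n x * ρ n x)
    (hωθψx : ∀ n x, deriv (ωθψ n) x = θ n x * ψ n x)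
    (hω0 : ∀ n x, ωθρ n x ≠ 0) :
    FwdLin a (fun n x => ωθρ n x * τ n x)
        (fun n x => φ n x - θ n x * (ωθρ n x)⁻¹ * ωφρ n x)
    ∧ BwdLin a (fun n x => ωθρ n x * τ n x)
        (fun n x => ψ n x - ρ n x * (ωθρ n x)⁻¹ * ωθψ n x) := by
  have diff {f : (Fin 3 → ℤ) → ℝ → ℂ} (hf : ∀ n, ContDiff ℝ (⊤ : ℕ∞) (f n)) (n x) :
      DifferentiableAt ℝ (f n) x := (hf n).differentiable (by simp) x
  have hlog (n x) := deriv_mul_div_self (diff hωθρsmooth n x) (diff hτsmooth n x) (hω0 n x)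
    (hτ0 n x)
  simp only [hωθρx] at hlog
  have bwd_pot {f g ω : (Fin 3 → ℤ) → ℝ → ℂ}
      (h : ∀ i : Fin 3, ∀ n x, a i * (ω (fwd i n) x - ω n x) = f n x * g (fwd i n) x)
      (i n x) : -a i * (ω (bwd i n) x - ω n x) = g n x * f (bwd i n) x := by
    have := h i (bwd i n) x
    rw [fwd_bwd] at this
    linear_combination this
  refine ⟨⟨fun i j hij n x => ?_, fun i n x => ?_⟩, ⟨fun i j hij n x => ?_, fun i n x => ?_⟩⟩
  · have hρij : a i * ρ (fwd j n) x - a j * ρ (fwd i n) x = (a i - a j) *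
        (τ (fwd i (fwd j n)) x * τ n x / (τ (fwd i n) x * τ (fwd j n) x))
          * ρ (fwd i (fwd j n)) x := by
      have h := hρ.1 i j hij (fwd i (fwd j n)) x
      have hj : bwd j (fwd i (fwd j n)) = fwd i n := by rw [fwd_comm, bwd_fwd]
      rw [hj, bwd_fwd, bwd_fwd] at h
      rw [h]; ring
    have h := darboux_discrete (ha i) (ha j) (hω0 n x) (hω0 _ x) (hω0 _ x)
      (hθ.1 i j hij n x) (hφ.1 i j hij n x) hρij (hωθρd i n x) (hωθρd j n x)
      (hωθρd i (fwd j n) x) (hωφρd i n x) (hωφρd j n x)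
    rw [h, mul_mul_mul_comm, mul_mul_mul_comm (ωθρ _ x) _ (ωθρ _ x), mul_div_mul_comm]
    ring
  · rw [deriv_darboux (diff hφsmooth n x) (diff hθsmooth n x) (diff hωθρsmooth n x)
      (diff hωφρsmooth n x) (hω0 n x), hlog, hlog, hωθρx, hωφρx]
    exact darboux_continuous (hω0 n x) (hω0 _ x) (hθ.2 i n x) (hφ.2 i n x)
      (hωθρd i n x) (hωφρd i n x)
  · have hθij : -a i * θ (bwd j n) x - -a j * θ (bwd i n) x = -((a i - a j) *
        (τ (bwd i (bwd j n)) x * τ n x / (τ (bwd i n) x * τ (bwd j n) x)))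
          * θ (bwd i (bwd j n)) x := by
      have h := hθ.1 i j hij (bwd i (bwd j n)) x
      have hj : fwd j (bwd i (bwd j n)) = bwd i n := by rw [bwd_comm, fwd_bwd]
      rw [hj, fwd_bwd, fwd_bwd] at h
      linear_combination -h
    have h := darboux_discrete (θi := ρ (bwd i n) x) (θj := ρ (bwd j n) x)
      (φi := ψ (bwd i n) x) (φj := ψ (bwd j n) x) (neg_ne_zero.2 (ha i)) (neg_ne_zero.2 (ha j))
      (hω0 n x) (hω0 _ x) (hω0 _ x)
      (by linear_combination -hρ.1 i j hij n x) (by linear_combination -hψ.1 i j hij n x) hθij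
      (bwd_pot hωθρd i n x) (bwd_pot hωθρd j n x) (bwd_pot hωθρd i (bwd j n) x)
      (bwd_pot hωθψd i n x) (bwd_pot hωθψd j n x)
    rw [mul_mul_mul_comm, mul_mul_mul_comm (ωθρ _ x) _ (ωθρ _ x), mul_div_mul_comm]
    linear_combination -h
  · rw [deriv_darboux (diff hψsmooth n x) (diff hρsmooth n x) (diff hωθρsmooth n x)
      (diff hωθψsmooth n x) (hω0 n x), hlog, hlog, hωθρx, hωθψx]
    have := darboux_continuous (ρ := θ n x) (hω0 n x) (hω0 (bwd i n) x)
      ((hρ.2 i n x).trans (by rw [sub_neg_eq_add])) ((hψ.2 i n x).trans (by rw [sub_neg_eq_add]))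
      (bwd_pot hωθρd i n x) (bwd_pot hωθψd i n x)
    rw [sub_neg_eq_add] at this
    linear_combination this
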